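/- arXiv:1603.08493 — 4 statements merged into one kernel-verified Lean document; each statement's English description precedes it below -/
import Mathlib

section
/- If m is an α-Meertens number in base b ≥ 2, then m < b^(b^1.02041) (where b^1.02041 is a real power). -/
/-- `N_b(m) = ∏ pᵢ^{dᵢ+1}`, where `d₁,…,d_n` are the base-`b` digits of `m`
(most significant first) and `pᵢ` is the `i`-th prime. -/
noncomputable def alphaMeertensMap (b m : ℕ) : ℕ :=
  ∏ i ∈ Finset.range (Nat.digits b m).length,
    Nat.nth Nat.Prime i ^ ((Nat.digits b m).reverse.getD i 0 + 1)

/-- `m` is an α-Meertens number in base `b`: `b ≥ 2`, `m > 0` and `N_b(m) = m`. -/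
def IsAlphaMeertens (b m : ℕ) : Prop :=
  2 ≤ b ∧ 0 < m ∧ alphaMeertensMap b m = m

/-- Primes greater than `3` lie in two classes modulo `6`, so every second one is at least `6`
larger. -/
theorem nth_prime_add_six_le {i : ℕ} (hi : 2 ≤ i) :
    Nat.nth Nat.Prime i + 6 ≤ Nat.nth Nat.Prime (i + 2) := by
  have hmono := Nat.nth_strictMono Nat.infinite_setOfPred_prime
  have h5 : ∀ j, 2 ≤ j → 5 ≤ Nat.nth Nat.Prime j := fun j hj =>
    Nat.nth_prime_two_eq_five ▸ hmono.monotone hj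
  have hmod : ∀ j, 2 ≤ j →
      Nat.nth Nat.Prime j % 6 = 1 ∨ Nat.nth Nat.Prime j % 6 = 5 := by
    intro j hj
    have hp := Nat.prime_nth_prime j
    have hge := h5 j hj
    have h2 : ¬ 2 ∣ Nat.nth Nat.Prime j := fun h => by
      have := (Nat.prime_dvd_prime_iff_eq Nat.prime_two hp).1 h
      omega
    have h3 : ¬ 3 ∣ Nat.nth Nat.Prime j := fun h => by
      have := (Nat.prime_dvd_prime_iff_eq Nat.prime_three hp).1 h
      omega
    omega
  have ha := hmod i hi
  have hb := hmod (i + 1) (by omega)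
  have hc := hmod (i + 2) (by omega)
  have hab : Nat.nth Nat.Prime i < Nat.nth Nat.Prime (i + 1) := hmono (by omega)
  have hbc : Nat.nth Nat.Prime (i + 1) < Nat.nth Nat.Prime (i + 2) := hmono (by omega)
  omega

theorem nth_prime_eq {i p : ℕ} (hp : p.Prime) (hc : Nat.count Nat.Prime p = i) :
    Nat.nth Nat.Prime i = p :=
  hc ▸ Nat.nth_count hp

theorem three_mul_add_one_le_nth_prime {i : ℕ} (hi : 9 ≤ i) :
    3 * i + 1 ≤ Nat.nth Nat.Prime i := by
  induction i using Nat.strong_induction_on with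
  | _ i ih =>
    obtain rfl | rfl | h : i = 9 ∨ i = 10 ∨ 11 ≤ i := by omega
    · rw [nth_prime_eq (p := 29) (by norm_num) (by decide)]; norm_num
    · rw [nth_prime_eq (p := 31) (by norm_num) (by decide)]
    · obtain ⟨j, rfl⟩ : ∃ j, i = j + 2 := ⟨i - 2, by omega⟩
      have := ih j (by omega) (by omega)
      have := nth_prime_add_six_le (i := j) (by omega)
      omega

theorem succ_pow_succ_le_exp_mul {n : ℕ} (hn : 0 < n) :
    ((n : ℝ) + 1) ^ (n + 1) ≤ Real.exp 1 * (n + 1) * (n : ℝ) ^ n := by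
  have hn' : (0 : ℝ) < n := by exact_mod_cast hn
  have h1 : ((n : ℝ)⁻¹ + 1) ^ n ≤ Real.exp 1 := by
    calc ((n : ℝ)⁻¹ + 1) ^ n ≤ Real.exp (n : ℝ)⁻¹ ^ n := by
          gcongr
          exact Real.add_one_le_exp _
      _ = Real.exp 1 := by
          rw [← Real.exp_nat_mul, mul_inv_cancel₀ hn'.ne']
  calc ((n : ℝ) + 1) ^ (n + 1) = ((n : ℝ)⁻¹ + 1) ^ n * (n + 1) * (n : ℝ) ^ n := by
        have : (n : ℝ) + 1 = ((n : ℝ)⁻¹ + 1) * n := by field_simp; ring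
        rw [pow_succ]
        nth_rewrite 1 [this]
        rw [mul_pow]
        ring
    _ ≤ Real.exp 1 * (n + 1) * (n : ℝ) ^ n := by gcongr

theorem pow_self_le_two_mul_prod_nth_prime_of_le_ten {n : ℕ} (hn : n ≤ 10) :
    n ^ n ≤ 2 * ∏ i ∈ Finset.range n, Nat.nth Nat.Prime i := by
  have h0 := nth_prime_eq (i := 0) (p := 2) (by norm_num) (by decide)
  have h1 := nth_prime_eq (i := 1) (p := 3) (by norm_num) (by decide)
  have h2 := nth_prime_eq (i := 2) (p := 5) (by norm_num) (by decide)
  have h3 := nth_prime_eq (i := 3) (p := 7) (by norm_num) (by decide)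
  have h4 := nth_prime_eq (i := 4) (p := 11) (by norm_num) (by decide)
  have h5 := nth_prime_eq (i := 5) (p := 13) (by norm_num) (by decide)
  have h6 := nth_prime_eq (i := 6) (p := 17) (by norm_num) (by decide)
  have h7 := nth_prime_eq (i := 7) (p := 19) (by norm_num) (by decide)
  have h8 := nth_prime_eq (i := 8) (p := 23) (by norm_num) (by decide)
  have h9 := nth_prime_eq (i := 9) (p := 29) (by norm_num) (by decide)
  interval_cases n <;>
    simp only [Finset.prod_range_succ, Finset.prod_range_zero, h0, h1, h2, h3, h4, h5, h6, h7,
      h8, h9] <;> norm_num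

/-- Twice the product of the first `n` primes is at least `n ^ n`. -/
theorem pow_self_le_two_mul_prod_nth_prime (n : ℕ) :
    n ^ n ≤ 2 * ∏ i ∈ Finset.range n, Nat.nth Nat.Prime i := by
  obtain hn | hn := le_total n 10
  · exact pow_self_le_two_mul_prod_nth_prime_of_le_ten hn
  induction n, hn using Nat.le_induction with
  | base => exact pow_self_le_two_mul_prod_nth_prime_of_le_ten le_rfl
  | succ n hn ih =>
    have hp : Real.exp 1 * (n + 1) ≤ (Nat.nth Nat.Prime n : ℝ) := by
      have h3 : (3 * n + 1 : ℝ) ≤ (Nat.nth Nat.Prime n : ℝ) := by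
        exact_mod_cast three_mul_add_one_le_nth_prime (i := n) (by omega)
      have hn' : (10 : ℝ) ≤ n := by exact_mod_cast hn
      nlinarith [Real.exp_one_lt_d9]
    have ih' : (n : ℝ) ^ n ≤ 2 * ∏ i ∈ Finset.range n, (Nat.nth Nat.Prime i : ℝ) := by
      exact_mod_cast ih
    have key : ((n : ℝ) + 1) ^ (n + 1) ≤
        2 * ∏ i ∈ Finset.range (n + 1), (Nat.nth Nat.Prime i : ℝ) := by
      calc ((n : ℝ) + 1) ^ (n + 1) ≤ Real.exp 1 * (n + 1) * (n : ℝ) ^ n :=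
            succ_pow_succ_le_exp_mul (by omega)
        _ ≤ Nat.nth Nat.Prime n * (2 * ∏ i ∈ Finset.range n, (Nat.nth Nat.Prime i : ℝ)) := by
            gcongr
        _ = 2 * ∏ i ∈ Finset.range (n + 1), (Nat.nth Nat.Prime i : ℝ) := by
            rw [Finset.prod_range_succ]; ring
    exact_mod_cast key

/-- The leading digit is at least `1`, so the prime `2` occurs with exponent at least `2`. -/
theorem two_mul_prod_nth_prime_le_alphaMeertensMap {b m : ℕ} (hm : m ≠ 0) :
    2 * ∏ i ∈ Finset.range (Nat.digits b m).length, Nat.nth Nat.Prime i ≤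
      alphaMeertensMap b m := by
  have hnil : Nat.digits b m ≠ [] := Nat.digits_ne_nil_iff_ne_zero.2 hm
  have hlead : (Nat.digits b m).reverse.getD 0 0 ≠ 0 := by
    have hlast := Nat.getLast_digit_ne_zero b hm
    rwa [List.getLast_eq_head_reverse, List.head_eq_getElem,
      ← List.getD_eq_getElem (d := 0)] at hlast
  obtain ⟨k, hk⟩ := Nat.exists_eq_succ_of_ne_zero (List.length_pos_of_ne_nil hnil).ne'
  rw [alphaMeertensMap, hk, Nat.succ_eq_add_one, Finset.prod_range_succ',
    Finset.prod_range_succ', Nat.nth_prime_zero_eq_two]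
  calc _ = (∏ i ∈ Finset.range k, Nat.nth Nat.Prime (i + 1)) * 2 ^ (1 + 1) := by ring
    _ ≤ _ := by
      gcongr with i
      · exact Nat.le_self_pow (by omega) _
      · norm_num
      · omega

theorem length_digits_lt_of_isAlphaMeertens {b m : ℕ} (h : IsAlphaMeertens b m) :
    (Nat.digits b m).length < b := by
  obtain ⟨hb, hm, heq⟩ := h
  by_contra! hle
  have hlower := (pow_self_le_two_mul_prod_nth_prime _).trans
    (two_mul_prod_nth_prime_le_alphaMeertensMap (b := b) hm.ne')
  rw [heq] at hlower
  exact absurd (Nat.lt_base_pow_length_digits (m := m) hb)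
    (not_lt.2 ((Nat.pow_le_pow_left hle _).trans hlower))

theorem stmt_10 (b m : ℕ) (hb : 2 ≤ b) (hm : IsAlphaMeertens b m) :
    (m : ℝ) < (b : ℝ) ^ ((b : ℝ) ^ (1.02041 : ℝ)) := by
  have hb1 : (1 : ℝ) ≤ b := by exact_mod_cast (by omega : 1 ≤ b)
  have hlt : (m : ℝ) < (b : ℝ) ^ (Nat.digits b m).length := by
    exact_mod_cast Nat.lt_base_pow_length_digits hb
  have hlen : ((Nat.digits b m).length : ℝ) ≤ b := by
    exact_mod_cast (length_digits_lt_of_isAlphaMeertens hm).le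
  rw [← Real.rpow_natCast] at hlt
  exact hlt.trans_le (Real.rpow_le_rpow_of_exponent_le hb1
    (hlen.trans (Real.self_le_rpow_of_one_le hb1 (by norm_num))))
end

section
/- Fix an integer b ≥ 2 and let l* be the largest nonnegative integer l with b^l > p_l# (taken to be 0 if no positive such integer exists). If m is a zeroless Meertens number or a zeroless reverse Meertens number in base b, then m < b^(l*) ≤ b^(b^1.675) (real power). -/
/-- `M_b(m) = ∏ pᵢ^{dᵢ}`, where `d₁,…,d_n` are the base-`b` digits of `m`
(most significant first, so `d₁ > 0`) and `pᵢ` is the `i`-th prime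
(`Nat.nth Nat.Prime (i-1)`). -/
noncomputable def meertensMap (b m : ℕ) : ℕ :=
  ∏ i ∈ Finset.range (Nat.digits b m).length,
    Nat.nth Nat.Prime i ^ ((Nat.digits b m).reverse.getD i 0)

/-- `m` is a Meertens number in base `b`: `b ≥ 2`, `m > 0` and `M_b(m) = m`. -/
def IsMeertens (b m : ℕ) : Prop :=
  2 ≤ b ∧ 0 < m ∧ meertensMap b m = m

/-- `Mʳ_b(m) = ∏ pᵢ^{d_{n+1-i}}`: the `i`-th prime raised to the `i`-th least
significant base-`b` digit of `m`. -/
noncomputable def revMeertensMap (b m : ℕ) : ℕ :=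
  ∏ i ∈ Finset.range (Nat.digits b m).length,
    Nat.nth Nat.Prime i ^ ((Nat.digits b m).getD i 0)

/-- `m` is a reverse Meertens number in base `b`: `b ≥ 2`, `m > 0`, `Mʳ_b(m) = m`. -/
def IsRevMeertens (b m : ℕ) : Prop :=
  2 ≤ b ∧ 0 < m ∧ revMeertensMap b m = m

/-- `m` is a zeroless Meertens number in base `b`. -/
def IsZerolessMeertens (b m : ℕ) : Prop :=
  IsMeertens b m ∧ 0 ∉ Nat.digits b m

/-- `m` is a zeroless reverse Meertens number in base `b`. -/
def IsZerolessRevMeertens (b m : ℕ) : Prop :=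
  IsRevMeertens b m ∧ 0 ∉ Nat.digits b m

/-- The primorial `p_n# = ∏_{i=1}^n pᵢ`, the product of the first `n` primes. -/
noncomputable def nthPrimorial (n : ℕ) : ℕ :=
  ∏ i ∈ Finset.range n, Nat.nth Nat.Prime i

theorem factorial_succ_le_nthPrimorial (l : ℕ) : (l + 1).factorial ≤ nthPrimorial l := by
  induction l with
  | zero => simp [nthPrimorial]
  | succ l ih =>
    rw [Nat.factorial_succ, mul_comm, nthPrimorial, Finset.prod_range_succ]
    exact Nat.mul_le_mul ih (Nat.add_two_le_nth_prime l)

theorem succ_lt_exp_one_mul_of_factorial_lt_pow {b l : ℕ} (h : (l + 1).factorial < b ^ l) :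
    (l + 1 : ℝ) < Real.exp 1 * b := by
  by_contra! hle
  have hb : 1 ≤ b := by
    rcases Nat.eq_zero_or_pos b with rfl | hb
    · rcases l with _ | l <;> simp at h
    · exact hb
  have hfact : (0 : ℝ) < (l + 1).factorial := by exact_mod_cast Nat.factorial_pos _
  have hexp := Real.pow_div_factorial_le_exp (l + 1 : ℝ) (by positivity) (l + 1)
  rw [div_le_iff₀ hfact] at hexp
  have hE : Real.exp (l + 1 : ℝ) = Real.exp 1 ^ (l + 1) := by
    rw [← Real.exp_nat_mul]; push_cast; ring_nf
  have hpow : (Real.exp 1 * b) ^ (l + 1) ≤ (l + 1 : ℝ) ^ (l + 1) := by gcongr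
  rw [mul_pow] at hpow
  rw [hE] at hexp
  have hb_pow : (b : ℝ) ^ (l + 1) ≤ (l + 1).factorial :=
    le_of_mul_le_mul_left (hpow.trans hexp) (by positivity)
  have hb_pow' : b ^ (l + 1) ≤ (l + 1).factorial := by exact_mod_cast hb_pow
  have := Nat.pow_le_pow_right hb (Nat.le_add_right l 1)
  omega

theorem natCast_le_rpow_of_pow_le {b l p q : ℕ} {r : ℝ} (hb : 1 ≤ b) (hq : 0 < q)
    (hr : (p : ℝ) / q ≤ r) (h : l ^ q ≤ b ^ p) : (l : ℝ) ≤ (b : ℝ) ^ r := by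
  have hb' : (1 : ℝ) ≤ b := by exact_mod_cast hb
  refine le_trans ?_ (Real.rpow_le_rpow_of_exponent_le hb' hr)
  refine le_of_pow_le_pow_left₀ hq.ne' (by positivity) ?_
  rw [← Real.rpow_mul_natCast (by positivity), div_mul_cancel₀ _ (by positivity),
    Real.rpow_natCast]
  exact_mod_cast h

theorem le_rpow_of_nthPrimorial_lt_pow {b l : ℕ} (hb : 2 ≤ b) (h : nthPrimorial l < b ^ l) :
    (l : ℝ) ≤ (b : ℝ) ^ (1.675 : ℝ) := by
  have hfact := (factorial_succ_le_nthPrimorial l).trans_lt h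
  have hlt := succ_lt_exp_one_mul_of_factorial_lt_pow hfact
  have he := Real.exp_one_lt_d9
  have hb' : (2 : ℝ) ≤ b := by exact_mod_cast hb
  rcases Nat.lt_or_ge b 5 with hb5 | hb5
  · have hl : l < 3 * b := by
      have : (l : ℝ) < 3 * b := by nlinarith
      exact_mod_cast this
    refine natCast_le_rpow_of_pow_le (p := 3) (q := 2) (by omega) (by norm_num) (by norm_num) ?_
    interval_cases b <;> interval_cases l <;> simp_all [Nat.factorial]
  · have hb5' : (5 : ℝ) ≤ b := by exact_mod_cast hb5
    have he3 : Real.exp 1 ^ 3 ≤ (b : ℝ) ^ 2 := by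
      calc Real.exp 1 ^ 3 ≤ (2.7182818286 : ℝ) ^ 3 := by gcongr
        _ ≤ 5 ^ 2 := by norm_num
        _ ≤ (b : ℝ) ^ 2 := by gcongr
    refine natCast_le_rpow_of_pow_le (p := 5) (q := 3) (by omega) (by norm_num) (by norm_num) ?_
    have : (l : ℝ) ^ 3 ≤ (b : ℝ) ^ 5 := by
      calc (l : ℝ) ^ 3 ≤ (Real.exp 1 * b) ^ 3 := by gcongr; linarith
        _ = Real.exp 1 ^ 3 * (b : ℝ) ^ 3 := mul_pow ..
        _ ≤ (b : ℝ) ^ 2 * (b : ℝ) ^ 3 := by gcongr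
        _ = (b : ℝ) ^ 5 := by ring
    exact_mod_cast this

theorem nthPrimorial_le_prod_pow_getD {L : List ℕ} (h : 0 ∉ L) :
    nthPrimorial L.length ≤ ∏ i ∈ Finset.range L.length, Nat.nth Nat.Prime i ^ L.getD i 0 := by
  refine Finset.prod_le_prod' fun i hi => Nat.le_self_pow ?_ _
  rw [Finset.mem_range] at hi
  rw [List.getD_eq_getElem _ _ hi]
  exact fun h0 => h (h0 ▸ List.getElem_mem hi)

theorem stmt_17 (b : ℕ) (hb : 2 ≤ b) (lstar : ℕ)
    (hlub : ∀ l : ℕ, nthPrimorial l < b ^ l → l ≤ lstar)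
    (hlmem : lstar = 0 ∨ nthPrimorial lstar < b ^ lstar)
    (m : ℕ) (hm : IsZerolessMeertens b m ∨ IsZerolessRevMeertens b m) :
    m < b ^ lstar ∧ ((b : ℝ) ^ lstar ≤ (b : ℝ) ^ ((b : ℝ) ^ (1.675 : ℝ))) := by
  have hle : nthPrimorial (Nat.digits b m).length ≤ m := by
    rcases hm with ⟨⟨-, -, hM⟩, hz⟩ | ⟨⟨-, -, hM⟩, hz⟩
    · have := nthPrimorial_le_prod_pow_getD (L := (Nat.digits b m).reverse) (by simpa using hz)
      rw [List.length_reverse] at this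
      exact this.trans_eq hM
    · exact (nthPrimorial_le_prod_pow_getD hz).trans_eq hM
  have hlt : m < b ^ (Nat.digits b m).length := Nat.lt_base_pow_length_digits hb
  refine ⟨hlt.trans_le (Nat.pow_le_pow_right (by omega) (hlub _ (hle.trans_lt hlt))), ?_⟩
  have hb' : (1 : ℝ) ≤ b := by exact_mod_cast (by omega : 1 ≤ b)
  rw [← Real.rpow_natCast]
  refine Real.rpow_le_rpow_of_exponent_le hb' ?_
  rcases hlmem with rfl | hlmem
  · simp only [Nat.cast_zero]
    positivity
  · exact le_rpow_of_nthPrimorial_lt_pow hb hlmem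
end

section
/- (i) For bases b with 2 ≤ b < 12, the number 6 (in base 5) is the only zeroless Meertens number, i.e., m is a zeroless Meertens number in base b < 12 if and only if m = 6 and b = 5. (ii) For bases b with 2 ≤ b < 12, the numbers 6 (in base 5) and 12 (in base 10) are the only zeroless reverse Meertens numbers. (iii) There are no zeroless Meertens numbers or zeroless reverse Meertens numbers in bases 13, 14, or 15. (iv) The number 36 is the only zeroless Meertens number and the only zeroless reverse Meertens number in base 17. -/
/-- The first ten primes, padded with ones. -/
def smallPrime (i : ℕ) : ℕ := [2, 3, 5, 7, 11, 13, 17, 19, 23, 29].getD i 1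

theorem nth_prime_eq_smallPrime {i : ℕ} (hi : i < 10) :
    Nat.nth Nat.Prime i = smallPrime i := by
  have key (i p : ℕ) (hp : p.Prime) (hc : Nat.count Nat.Prime p = i) :
      Nat.nth Nat.Prime i = p := hc ▸ Nat.nth_count hp
  interval_cases i <;> exact key _ _ (by norm_num [smallPrime]) (by decide +kernel)

theorem prod_nth_prime_eq_prod_smallPrime {n : ℕ} (hn : n ≤ 10) (e : ℕ → ℕ) :
    ∏ i ∈ Finset.range n, Nat.nth Nat.Prime i ^ e i =
      ∏ i ∈ Finset.range n, smallPrime i ^ e i := by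
  refine Finset.prod_congr rfl fun i hi => ?_
  rw [nth_prime_eq_smallPrime (by have := Finset.mem_range.1 hi; omega)]

theorem primorial_eq_prod_smallPrime {n : ℕ} (hn : n ≤ 10) :
    ∏ i ∈ Finset.range n, Nat.nth Nat.Prime i = ∏ i ∈ Finset.range n, smallPrime i := by
  simpa using prod_nth_prime_eq_prod_smallPrime hn fun _ => 1

theorem prod_dvd_prod_pow_getD (f : ℕ → ℕ) {L : List ℕ} (h0 : 0 ∉ L) :
    ∏ i ∈ Finset.range L.length, f i ∣ ∏ i ∈ Finset.range L.length, f i ^ L.getD i 0 := by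
  refine Finset.prod_dvd_prod_of_dvd _ _ fun i hi => dvd_pow_self _ fun h => h0 ?_
  rw [List.getD_eq_getElem _ _ (Finset.mem_range.1 hi)] at h
  exact h ▸ List.getElem_mem _

theorem nine_pow_lt_prod_nth_prime {n : ℕ} (hn : 10 ≤ n) :
    9 ^ n < ∏ i ∈ Finset.range n, Nat.nth Nat.Prime i := by
  induction n, hn using Nat.le_induction with
  | base =>
    rw [primorial_eq_prod_smallPrime le_rfl]
    decide +kernel
  | succ n hn ih =>
    rw [Finset.prod_range_succ, pow_succ]
    have : Nat.nth Nat.Prime 9 ≤ Nat.nth Nat.Prime n :=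
      Nat.nth_monotone Nat.infinite_setOfPred_prime (by omega)
    rw [nth_prime_eq_smallPrime (by norm_num)] at this
    exact Nat.mul_lt_mul_of_lt_of_le ih (le_trans (by decide) this) (Nat.prime_nth_prime n).pos

theorem not_dvd_of_zero_notMem_digits {b m : ℕ} (hb : 2 ≤ b) (hm : 0 < m)
    (h0 : 0 ∉ Nat.digits b m) : ¬ b ∣ m := by
  intro h
  rw [Nat.digits_def' hb hm, Nat.mod_eq_zero_of_dvd h] at h0
  exact h0 List.mem_cons_self

/-- The bases in which zeroless Meertens numbers are classified below. -/
def smallBases : List ℕ := [2, 3, 4, 5, 6, 7, 8, 9, 10, 11, 13, 14, 15, 17]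

theorem length_digits_lt_ten {b m : ℕ} (hb : b ∈ smallBases) (hm : 0 < m)
    (h0 : 0 ∉ Nat.digits b m)
    (hd : ∏ i ∈ Finset.range (Nat.digits b m).length, Nat.nth Nat.Prime i ∣ m) :
    (Nat.digits b m).length < 10 := by
  by_contra! hn
  have hb2 : 2 ≤ b := (by decide : ∀ b ∈ smallBases, 2 ≤ b) b hb
  rcases (by decide +kernel : ∀ b ∈ smallBases, b ≤ 9 ∨
    b ∣ ∏ i ∈ Finset.range 10, smallPrime i) b hb with h | h
  · have h1 := nine_pow_lt_prod_nth_prime hn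
    have h2 := Nat.le_of_dvd hm hd
    have h3 := Nat.lt_base_pow_length_digits (b := b) (m := m) hb2
    have h4 := Nat.pow_le_pow_left h (Nat.digits b m).length
    omega
  · rw [← primorial_eq_prod_smallPrime le_rfl] at h
    refine not_dvd_of_zero_notMem_digits hb2 hm h0 ((h.trans ?_).trans hd)
    exact Finset.prod_dvd_prod_of_subset _ _ _ (Finset.range_subset_range.2 hn)

/-- If the number `m` with `n + 1` digits in base `b` is a (reverse) Meertens number, then it is
one of the known zeroless ones. The digits are computed by division, the primes are given by
`smallPrime`, and the equation for `m` is preceded by a divisibility condition that it implies,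
so that the condition can be decided quickly. -/
def IsListed (b n m : ℕ) : Prop :=
  (smallPrime n ^ (m % b) ∣ m →
    ∏ i ∈ Finset.range (n + 1), smallPrime i ^ (m / b ^ (n - i) % b) = m →
      m = 6 ∧ b = 5 ∨ m = 36 ∧ b = 17) ∧
  (smallPrime 0 ^ (m % b) ∣ m →
    ∏ i ∈ Finset.range (n + 1), smallPrime i ^ (m / b ^ i % b) = m →
      m = 6 ∧ b = 5 ∨ m = 12 ∧ b = 10 ∨ m = 36 ∧ b = 17)

instance (b n m : ℕ) : Decidable (IsListed b n m) := by
  unfold IsListed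
  infer_instance

theorem smallBases_search : ∀ b ∈ smallBases, ∀ n < 9,
    b ∣ ∏ i ∈ Finset.range (n + 1), smallPrime i ∨
    ∀ k < b ^ (n + 1) / (∏ i ∈ Finset.range (n + 1), smallPrime i) + 1,
      IsListed b n ((∏ i ∈ Finset.range (n + 1), smallPrime i) * k) := by
  decide +kernel

theorem meertensMap_eq_prod_smallPrime {b m n : ℕ} (hb : 2 ≤ b) (hn : n < 10)
    (hl : (Nat.digits b m).length = n + 1) :
    meertensMap b m = ∏ i ∈ Finset.range (n + 1), smallPrime i ^ (m / b ^ (n - i) % b) := by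
  rw [meertensMap, hl, prod_nth_prime_eq_prod_smallPrime hn]
  refine Finset.prod_congr rfl fun i hi => ?_
  have hi := Finset.mem_range.1 hi
  rw [← Nat.getD_digits m (n - i) hb, List.getD_eq_getElem?_getD,
    List.getElem?_reverse (by omega), ← List.getD_eq_getElem?_getD, hl]
  congr 2

theorem revMeertensMap_eq_prod_smallPrime {b m n : ℕ} (hb : 2 ≤ b) (hn : n < 10)
    (hl : (Nat.digits b m).length = n + 1) :
    revMeertensMap b m = ∏ i ∈ Finset.range (n + 1), smallPrime i ^ (m / b ^ i % b) := by
  rw [revMeertensMap, hl, prod_nth_prime_eq_prod_smallPrime hn]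
  exact Finset.prod_congr rfl fun i _ => by rw [Nat.getD_digits m i hb]

theorem smallBases_candidates {b m : ℕ} (hb : b ∈ smallBases) (hm : 0 < m)
    (h0 : 0 ∉ Nat.digits b m)
    (hd : ∏ i ∈ Finset.range (Nat.digits b m).length, Nat.nth Nat.Prime i ∣ m) :
    (meertensMap b m = m → m = 6 ∧ b = 5 ∨ m = 36 ∧ b = 17) ∧
    (revMeertensMap b m = m → m = 6 ∧ b = 5 ∨ m = 12 ∧ b = 10 ∨ m = 36 ∧ b = 17) := by
  have hb2 : 2 ≤ b := (by decide : ∀ b ∈ smallBases, 2 ≤ b) b hb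
  have hn := length_digits_lt_ten hb hm h0 hd
  have hlt := Nat.lt_base_pow_length_digits (b := b) (m := m) hb2
  obtain ⟨n, hl⟩ := Nat.exists_eq_add_one_of_ne_zero
    (List.length_pos_iff.2 (Nat.digits_ne_nil_iff_ne_zero.2 hm.ne')).ne'
  rw [hl] at hn hd hlt
  rw [primorial_eq_prod_smallPrime hn.le] at hd
  rw [meertensMap_eq_prod_smallPrime hb2 (by omega) hl,
    revMeertensMap_eq_prod_smallPrime hb2 (by omega) hl]
  rcases smallBases_search b hb n (by omega) with h | h
  · exact absurd (h.trans hd) (not_dvd_of_zero_notMem_digits hb2 hm h0)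
  · obtain ⟨k, hk⟩ := hd
    have hpos := Nat.pos_of_mul_pos_right (hk ▸ hm)
    have hlisted := h k (Nat.lt_succ_of_le ((Nat.le_div_iff_mul_le hpos).2
      (by rw [mul_comm, ← hk]; exact hlt.le)))
    rw [← hk] at hlisted
    refine ⟨fun e => hlisted.1 ?_ e, fun e => hlisted.2 ?_ e⟩
    · have := Finset.dvd_prod_of_mem (fun i => smallPrime i ^ (m / b ^ (n - i) % b))
        (Finset.self_mem_range_succ n)
      simpa [e] using this
    · have := Finset.dvd_prod_of_mem (fun i => smallPrime i ^ (m / b ^ i % b))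
        (Finset.mem_range.2 n.succ_pos)
      simpa [e] using this

theorem IsZerolessMeertens.eq_of_mem_smallBases {b m : ℕ} (h : IsZerolessMeertens b m)
    (hb : b ∈ smallBases) : m = 6 ∧ b = 5 ∨ m = 36 ∧ b = 17 := by
  obtain ⟨⟨-, hm, he⟩, h0⟩ := h
  refine (smallBases_candidates hb hm h0 ?_).1 he
  have := prod_dvd_prod_pow_getD (Nat.nth Nat.Prime) (L := (Nat.digits b m).reverse) (by simpa)
  rw [List.length_reverse] at this
  exact this.trans he.dvd

theorem IsZerolessRevMeertens.eq_of_mem_smallBases {b m : ℕ} (h : IsZerolessRevMeertens b m)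
    (hb : b ∈ smallBases) : m = 6 ∧ b = 5 ∨ m = 12 ∧ b = 10 ∨ m = 36 ∧ b = 17 := by
  obtain ⟨⟨-, hm, he⟩, h0⟩ := h
  exact (smallBases_candidates hb hm h0
    ((prod_dvd_prod_pow_getD (Nat.nth Nat.Prime) h0).trans he.dvd)).2 he

theorem isZerolessMeertens_five_six : IsZerolessMeertens 5 6 := by
  simp [IsZerolessMeertens, IsMeertens, meertensMap, Finset.prod_range_succ,
    nth_prime_eq_smallPrime, smallPrime]

theorem isZerolessRevMeertens_five_six : IsZerolessRevMeertens 5 6 := by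
  simp [IsZerolessRevMeertens, IsRevMeertens, revMeertensMap, Finset.prod_range_succ,
    nth_prime_eq_smallPrime, smallPrime]

theorem isZerolessRevMeertens_ten_twelve : IsZerolessRevMeertens 10 12 := by
  simp [IsZerolessRevMeertens, IsRevMeertens, revMeertensMap, Finset.prod_range_succ,
    nth_prime_eq_smallPrime, smallPrime]

theorem isZerolessMeertens_seventeen : IsZerolessMeertens 17 36 := by
  simp [IsZerolessMeertens, IsMeertens, meertensMap, Finset.prod_range_succ,
    nth_prime_eq_smallPrime, smallPrime]

theorem isZerolessRevMeertens_seventeen : IsZerolessRevMeertens 17 36 := by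
  simp [IsZerolessRevMeertens, IsRevMeertens, revMeertensMap, Finset.prod_range_succ,
    nth_prime_eq_smallPrime, smallPrime]

theorem stmt_18 :
    (∀ b m : ℕ, 2 ≤ b → b < 12 →
      (IsZerolessMeertens b m ↔ m = 6 ∧ b = 5)) ∧
    (∀ b m : ℕ, 2 ≤ b → b < 12 →
      (IsZerolessRevMeertens b m ↔ (m = 6 ∧ b = 5) ∨ (m = 12 ∧ b = 10))) ∧
    (∀ b m : ℕ, b = 13 ∨ b = 14 ∨ b = 15 →
      ¬ IsZerolessMeertens b m ∧ ¬ IsZerolessRevMeertens b m) ∧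
    (∀ m : ℕ, (IsZerolessMeertens 17 m ↔ m = 36) ∧
      (IsZerolessRevMeertens 17 m ↔ m = 36)) := by
  have mem (b : ℕ) (h : 2 ≤ b) (h' : b < 12) : b ∈ smallBases := by
    interval_cases b <;> decide
  refine ⟨fun b m h h' => ⟨fun hm => ?_, ?_⟩, fun b m h h' => ⟨fun hm => ?_, ?_⟩,
    fun b m h => ?_, fun m => ⟨⟨fun hm => ?_, ?_⟩, ⟨fun hm => ?_, ?_⟩⟩⟩
  · have := hm.eq_of_mem_smallBases (mem b h h')
    omega
  · rintro ⟨rfl, rfl⟩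
    exact isZerolessMeertens_five_six
  · have := hm.eq_of_mem_smallBases (mem b h h')
    omega
  · rintro (⟨rfl, rfl⟩ | ⟨rfl, rfl⟩)
    exacts [isZerolessRevMeertens_five_six, isZerolessRevMeertens_ten_twelve]
  · have hb : b ∈ smallBases := by rcases h with rfl | rfl | rfl <;> decide
    constructor <;> intro hm <;> have := hm.eq_of_mem_smallBases hb <;> omega
  · have := hm.eq_of_mem_smallBases (by decide)
    omega
  · rintro rfl
    exact isZerolessMeertens_seventeen
  · have := hm.eq_of_mem_smallBases (by decide)
    omega
  · rintro rfl
    exact isZerolessRevMeertens_seventeen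
end

section
/- Let m be a Meertens number or a reverse Meertens number in base b ≥ 2, let u be the number of base-b digits of m, and let z be the number of those digits equal to zero. Then (u − z)·log(u − z) < 1.675·u·log b (natural logarithms; the left side is interpreted as 0 when u = z). Equivalently, z > u − e^(W(1.675·u·log b)), where W is the Lambert W function. -/
theorem two_mul_add_one_le_nth_prime (i : ℕ) : 2 * i + 1 ≤ Nat.nth Nat.Prime i := by
  have hp : ∀ j, (Nat.nth Nat.Prime j).Prime := Nat.prime_nth_prime
  have hlt : ∀ j, Nat.nth Nat.Prime j < Nat.nth Nat.Prime (j + 1) := fun j =>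
    Nat.nth_strictMono Nat.infinite_setOfPred_prime (Nat.lt_succ_self j)
  induction i with
  | zero => exact (hp 0).one_lt.le
  | succ i ih =>
    have h := hlt i
    rcases Nat.eq_zero_or_pos i with rfl | hi
    · have := (hp 0).two_le
      omega
    · obtain ⟨a, ha⟩ := (hp i).odd_of_ne_two (by omega)
      obtain ⟨c, hc⟩ := (hp (i + 1)).odd_of_ne_two (by omega)
      omega

/-- If `f ≤ g` with `f` nondecreasing and `l` has `k` nonzero entries, the product of the first
`k` values of `f` is at most the product of the values of `g` raised to the entries of `l`. -/
theorem prod_range_le_prod_pow_getD {f g : ℕ → ℕ} (hf : Monotone f) (hfg : ∀ i, f i ≤ g i)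
    (l : List ℕ) :
    ∏ i ∈ Finset.range (l.length - l.count 0), f i ≤
      ∏ i ∈ Finset.range l.length, g i ^ l.getD i 0 := by
  induction l using List.reverseRecOn with
  | nil => simp
  | append_singleton l d ih =>
    have hle : l.count 0 ≤ l.length := List.count_le_length
    have hprefix : ∏ i ∈ Finset.range l.length, g i ^ (l ++ [d]).getD i 0 =
        ∏ i ∈ Finset.range l.length, g i ^ l.getD i 0 :=
      Finset.prod_congr rfl fun i hi => by
        rw [List.getD_append _ _ _ _ (Finset.mem_range.mp hi)]
    have hlast : (l ++ [d]).getD l.length 0 = d := by simp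
    rw [List.length_append, List.length_singleton, Finset.prod_range_succ, hprefix, hlast,
      List.count_append]
    rcases Nat.eq_zero_or_pos d with rfl | hd
    · simpa using ih
    · have hcount : List.count 0 [d] = 0 := by simp [hd.ne']
      rw [hcount, Nat.add_zero (List.count 0 l), Nat.sub_add_comm hle, Finset.prod_range_succ]
      refine Nat.mul_le_mul ih ?_
      calc f (l.length - l.count 0) ≤ f l.length := hf (Nat.sub_le _ _)
        _ ≤ g l.length := hfg _
        _ ≤ g l.length ^ d := Nat.le_self_pow hd.ne' _

theorem mul_log_le_log_prod_odd (k : ℕ) :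
    (k : ℝ) * Real.log k ≤
      1.675 * Real.log ((∏ i ∈ Finset.range k, (2 * i + 1) : ℕ) : ℝ) := by
  induction k with
  | zero => simp
  | succ k ih =>
    rcases Nat.eq_zero_or_pos k with rfl | hk
    · simp
    have hk1 : (1 : ℝ) ≤ k := by exact_mod_cast hk
    have hprod : ((∏ i ∈ Finset.range k, (2 * i + 1) : ℕ) : ℝ) ≠ 0 := by
      exact_mod_cast (Finset.prod_pos fun i _ => Nat.succ_pos _).ne'
    rw [Finset.prod_range_succ, Nat.cast_mul, Real.log_mul hprod (by positivity)]
    push_cast at ih ⊢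
    have hdiff : (k : ℝ) * (Real.log (k + 1) - Real.log k) ≤ 1 := by
      rw [← Real.log_div (by positivity) (by positivity)]
      have h := Real.log_le_sub_one_of_pos (show (0 : ℝ) < (k + 1) / k by positivity)
      calc (k : ℝ) * Real.log ((k + 1) / k) ≤ k * ((k + 1) / k - 1) := by gcongr
        _ = 1 := by field_simp; ring
    have hodd : Real.log 3 - Real.log 2 + Real.log (k + 1) ≤ Real.log (2 * k + 1) := by
      rw [← Real.log_div (by norm_num) (by norm_num),
        ← Real.log_mul (by norm_num) (by positivity)]
      exact Real.log_le_log (by positivity) (by linarith)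
    have hk2 : Real.log 2 ≤ Real.log (k + 1) :=
      Real.log_le_log (by norm_num) (by linarith)
    have hlog3 : 3 * Real.log 2 ≤ 2 * Real.log 3 := by
      rw [← Real.log_rpow (by norm_num), ← Real.log_rpow (by norm_num)]
      exact Real.log_le_log (by positivity) (by norm_num)
    have hlog2 := Real.log_two_gt_d9
    nlinarith

theorem prod_odd_le_of_isMeertens_or_isRevMeertens {b m : ℕ}
    (hm : IsMeertens b m ∨ IsRevMeertens b m) :
    ∏ i ∈ Finset.range ((Nat.digits b m).length - (Nat.digits b m).count 0), (2 * i + 1) ≤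
      m := by
  have key := prod_range_le_prod_pow_getD (f := fun i => 2 * i + 1)
    (fun i j hij => by dsimp only; omega) two_mul_add_one_le_nth_prime
  rcases hm with ⟨-, -, h⟩ | ⟨-, -, h⟩
  · have := key (Nat.digits b m).reverse
    rw [List.length_reverse, List.count_reverse] at this
    exact this.trans_eq h
  · exact (key (Nat.digits b m)).trans_eq h

theorem stmt_19 (b m u z : ℕ) (hb : 2 ≤ b)
    (hm : IsMeertens b m ∨ IsRevMeertens b m)
    (hu : u = (Nat.digits b m).length)
    (hz : z = (Nat.digits b m).count 0) :
    ((u - z : ℕ) : ℝ) * Real.log ((u - z : ℕ) : ℝ) < 1.675 * (u : ℝ) * Real.log (b : ℝ) ∧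
    ∀ w : ℝ, 0 ≤ w → w * Real.exp w = 1.675 * (u : ℝ) * Real.log (b : ℝ) →
      (u : ℝ) - Real.exp w < (z : ℝ) := by
  have hprod := prod_odd_le_of_isMeertens_or_isRevMeertens hm
  have hzu : z ≤ u := hu ▸ hz ▸ List.count_le_length
  rw [← hu, ← hz] at hprod
  have hlt : m < b ^ u := hu ▸ Nat.lt_base_pow_length_digits hb
  have hlog : Real.log ((∏ i ∈ Finset.range (u - z), (2 * i + 1) : ℕ) : ℝ) <
      u * Real.log b := by
    rw [← Real.log_pow]
    refine Real.log_lt_log ?_ (by exact_mod_cast hprod.trans_lt hlt)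
    exact_mod_cast Finset.prod_pos fun i _ => Nat.succ_pos _
  have hmain : ((u - z : ℕ) : ℝ) * Real.log ((u - z : ℕ) : ℝ) <
      1.675 * (u : ℝ) * Real.log (b : ℝ) := by
    have := mul_log_le_log_prod_odd (u - z)
    linarith
  refine ⟨hmain, fun w hw hw_eq => ?_⟩
  by_contra! hle
  have hexp : Real.exp w ≤ ((u - z : ℕ) : ℝ) := by
    rw [Nat.cast_sub hzu]
    linarith
  have hw_log : w ≤ Real.log ((u - z : ℕ) : ℝ) :=
    (Real.le_log_iff_exp_le ((Real.exp_pos w).trans_le hexp)).mpr hexp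
  have hmul := mul_le_mul hexp hw_log hw (Nat.cast_nonneg _)
  linarith
end
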